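/- (Bailey's very-well-poised ₆ψ₆ summation formula.) Let q, a, b, c, d, e be nonzero complex numbers with 0 < |q| < 1 and |a²q/(bcde)| < 1, generic in the sense that every q-shifted factorial appearing in a denominator below is nonzero. Then Σ_{n∈ℤ} [(1 − aq^{2n})/(1 − a)]·(b,c,d,e;q)_n / (aq/b,aq/c,aq/d,aq/e;q)_n·(a²q/(bcde))^n = (q;q)_∞ (aq;q)_∞ (q/a;q)_∞ (aq/(be);q)_∞ (aq/(ce);q)_∞ (aq/(de);q)_∞ (aq/(bc);q)_∞ (aq/(bd);q)_∞ (aq/(cd);q)_∞ / [(aq/b;q)_∞ (aq/c;q)_∞ (aq/d;q)_∞ (aq/e;q)_∞ (q/b;q)_∞ (q/c;q)_∞ (q/d;q)_∞ (q/e;q)_∞ (a²q/(bcde);q)_∞]. -/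

import Mathlib

/-- The bilateral `q`-shifted factorial `(a;q)_n` for `n ∈ ℤ`:
`(a;q)_0 = 1`, `(a;q)_n = ∏_{j=0}^{n-1} (1 - a q^j)` for `n ≥ 1`, and
`(a;q)_{-n} = 1 / ∏_{j=1}^{n} (1 - a q^{-j})` for `n ≥ 1`. -/
noncomputable def qPoch (q a : ℂ) (n : ℤ) : ℂ :=
  if 0 ≤ n then ∏ j ∈ Finset.range n.toNat, (1 - a * q ^ j)
  else (∏ j ∈ Finset.range (-n).toNat, (1 - a * q ^ (-(j : ℤ) - 1)))⁻¹

/-- The infinite `q`-shifted factorial `(a;q)_∞ = ∏_{j=0}^{∞} (1 - a q^j)`. -/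
noncomputable def qPochInf (q a : ℂ) : ℂ := ∏' j : ℕ, (1 - a * q ^ j)

open Filter Finset Topology

/-- The finite `q`-shifted factorial `(x;q)_N`. -/
noncomputable def qPochFin (q x : ℂ) (N : ℕ) : ℂ := ∏ j ∈ range N, (1 - x * q ^ j)

theorem summable_norm_neg_mul_pow {q : ℂ} (hq : ‖q‖ < 1) (x : ℂ) :
    Summable fun j : ℕ => ‖-(x * q ^ j)‖ := by
  simp only [norm_neg, norm_mul, norm_pow]
  exact (summable_geometric_of_lt_one (norm_nonneg q) hq).mul_left _

theorem tendsto_qPochFin {q : ℂ} (hq : ‖q‖ < 1) (x : ℂ) :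
    Tendsto (qPochFin q x) atTop (𝓝 (qPochInf q x)) := by
  have h := (multipliable_one_add_of_summable (summable_norm_neg_mul_pow hq x)).hasProd
  simp only [← sub_eq_add_neg] at h
  exact h.tendsto_prod_nat

theorem qPochInf_ne_zero {q x : ℂ} (hq : ‖q‖ < 1) (hx : ∀ j : ℕ, 1 - x * q ^ j ≠ 0) :
    qPochInf q x ≠ 0 := by
  have h := tprod_one_add_ne_zero_of_summable (f := fun j : ℕ => -(x * q ^ j))
    (by simpa only [← sub_eq_add_neg] using hx) (summable_norm_neg_mul_pow hq x)
  simp only [← sub_eq_add_neg] at h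
  exact h

theorem qPochInf_eq_zero {q x : ℂ} (j : ℕ) (h : 1 - x * q ^ j = 0) : qPochInf q x = 0 :=
  tprod_of_exists_eq_zero ⟨j, h⟩

theorem one_sub_ne_zero_of_qPochInf_ne_zero {q x : ℂ} (h : qPochInf q x ≠ 0) (j : ℕ) :
    1 - x * q ^ j ≠ 0 := fun h0 => h (qPochInf_eq_zero j h0)

theorem qPochFin_add (q x : ℂ) (M N : ℕ) :
    qPochFin q x (M + N) = qPochFin q x M * qPochFin q (x * q ^ M) N := by
  simp only [qPochFin, prod_range_add, pow_add, mul_assoc]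

theorem exists_norm_le_of_tendsto {u : ℕ → ℂ} {l : ℂ} (h : Tendsto u atTop (𝓝 l)) :
    ∃ C : ℝ, 0 < C ∧ ∀ n, ‖u n‖ ≤ C := by
  obtain ⟨C, hC⟩ := h.norm.bddAbove_range
  exact ⟨max C 1, by positivity, fun n => (hC ⟨n, rfl⟩).trans (le_max_left _ _)⟩

/-- `y ^ n * (1/y;q)_n / (a q y;q)_n` for `n : ℕ`, in a form that makes sense at `y = 0`. -/
noncomputable def wpNat (q a y : ℂ) (n : ℕ) : ℂ :=
  ∏ j ∈ range n, (y - q ^ j) / (1 - a * q * y * q ^ j)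

theorem wpNat_zero (q a y : ℂ) : wpNat q a y 0 = 1 := rfl

theorem wpNat_succ (q a y : ℂ) (n : ℕ) :
    wpNat q a y (n + 1) = wpNat q a y n * ((y - q ^ n) / (1 - a * q * y * q ^ n)) :=
  prod_range_succ _ _

/-- `y ^ n * (1/y;q)_n / (a q y;q)_n` for `n : ℤ`, in a form that makes sense at `y = 0`. -/
noncomputable def wpInt (q a y : ℂ) : ℤ → ℂ
  | Int.ofNat n => wpNat q a y n
  | Int.negSucc n => q ^ (n + 1) * wpNat q a⁻¹ (a * y) (n + 1)

theorem wpInt_natCast (q a y : ℂ) (n : ℕ) : wpInt q a y n = wpNat q a y n := rfl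

theorem wpInt_neg_natCast (q a y : ℂ) (n : ℕ) :
    wpInt q a y (-n) = q ^ n * wpNat q a⁻¹ (a * y) n := by
  cases n with
  | zero => rw [pow_zero, one_mul]; rfl
  | succ n => rfl

/-- No denominator of `wpInt q a y` vanishes. -/
def WpAdmissible (q a y : ℂ) : Prop :=
  (∀ j : ℕ, 1 - a * q * y * q ^ j ≠ 0) ∧ ∀ j : ℕ, 1 - q * y * q ^ j ≠ 0

theorem WpAdmissible.mul_pow {q a y : ℂ} (h : WpAdmissible q a y) (N : ℕ) :
    WpAdmissible q a (y * q ^ N) := by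
  refine ⟨fun j => ?_, fun j => ?_⟩
  · convert h.1 (N + j) using 2; ring
  · convert h.2 (N + j) using 2; ring

theorem WpAdmissible.inv {q a y : ℂ} (ha : a ≠ 0) (h : WpAdmissible q a y) :
    WpAdmissible q a⁻¹ (a * y) := by
  refine ⟨fun j => ?_, fun j => ?_⟩
  · convert h.2 j using 2; field_simp
  · convert h.1 j using 2; ring

theorem prod_norm_sub_pow_le {q y : ℂ} (hq : ‖q‖ < 1) (hy : y ≠ 0) (N n : ℕ) :
    ∏ j ∈ range n, ‖y * q ^ N - q ^ j‖ ≤ Real.exp (‖y‖⁻¹ * (1 - ‖q‖)⁻¹) * ‖y‖ ^ n := by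
  have hy' : 0 < ‖y‖ := norm_pos_iff.2 hy
  have hfac : ∀ j ∈ range n, ‖y * q ^ N - q ^ j‖ ≤ Real.exp (‖y‖⁻¹ * ‖q‖ ^ j) * ‖y‖ := by
    intro j _
    calc ‖y * q ^ N - q ^ j‖ ≤ ‖y * q ^ N‖ + ‖q ^ j‖ := norm_sub_le _ _
      _ ≤ ‖y‖ + ‖q‖ ^ j := by
        rw [norm_mul, norm_pow, norm_pow]
        gcongr
        exact mul_le_of_le_one_right hy'.le (pow_le_one₀ (norm_nonneg _) hq.le)
      _ = (‖y‖⁻¹ * ‖q‖ ^ j + 1) * ‖y‖ := by field_simp; ring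
      _ ≤ _ := by gcongr; exact Real.add_one_le_exp _
  refine (prod_le_prod (fun _ _ => norm_nonneg _) hfac).trans ?_
  rw [prod_mul_distrib, prod_const, card_range, ← Real.exp_sum, ← mul_sum]
  gcongr
  rw [← tsum_geometric_of_lt_one (norm_nonneg _) hq]
  exact (summable_geometric_of_lt_one (norm_nonneg _) hq).sum_le_tsum _
    (fun _ _ => by positivity)

theorem exists_norm_wpNat_le {q a y : ℂ} (hq : ‖q‖ < 1) (hy : y ≠ 0)
    (h : ∀ j : ℕ, 1 - a * q * y * q ^ j ≠ 0) :
    ∃ C : ℝ, 0 < C ∧ ∀ N n : ℕ, ‖wpNat q a (y * q ^ N) n‖ ≤ C * ‖y‖ ^ n := by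
  have hlim := tendsto_qPochFin hq (a * q * y)
  obtain ⟨C₁, hC₁, h₁⟩ := exists_norm_le_of_tendsto hlim
  obtain ⟨C₂, hC₂, h₂⟩ := exists_norm_le_of_tendsto (hlim.inv₀ (qPochInf_ne_zero hq h))
  refine ⟨Real.exp (‖y‖⁻¹ * (1 - ‖q‖)⁻¹) * (C₂ * C₁), by positivity, fun N n => ?_⟩
  have hN : qPochFin q (a * q * y) N ≠ 0 := prod_ne_zero_iff.2 fun j _ => h j
  have e : wpNat q a (y * q ^ N) n = (∏ j ∈ range n, (y * q ^ N - q ^ j)) *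
      ((qPochFin q (a * q * y) (N + n))⁻¹ * qPochFin q (a * q * y) N) := by
    rw [qPochFin_add, mul_inv, mul_right_comm, inv_mul_cancel₀ hN, one_mul, ← div_eq_mul_inv,
      wpNat, prod_div_distrib]
    simp only [qPochFin, mul_assoc]
  rw [e, norm_mul, norm_mul, norm_prod, mul_right_comm _ (C₂ * C₁)]
  exact mul_le_mul (prod_norm_sub_pow_le hq hy N n)
    (mul_le_mul (h₂ _) (h₁ _) (norm_nonneg _) hC₂.le) (by positivity) (by positivity)

theorem exists_norm_wpInt_le {q a y : ℂ} (hq : ‖q‖ < 1) (ha : a ≠ 0) (hy : y ≠ 0)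
    (h : WpAdmissible q a y) :
    ∃ C : ℝ, 0 < C ∧ ∀ N n : ℕ, ‖wpInt q a (y * q ^ N) n‖ ≤ C * ‖y‖ ^ n ∧
      ‖wpInt q a (y * q ^ N) (-n)‖ ≤ C * ‖q * a * y‖ ^ n := by
  obtain ⟨C₁, hC₁, h₁⟩ := exists_norm_wpNat_le hq hy h.1
  obtain ⟨C₂, hC₂, h₂⟩ := exists_norm_wpNat_le hq (mul_ne_zero ha hy) (h.inv ha).1
  refine ⟨max C₁ C₂, by positivity, fun N n => ⟨?_, ?_⟩⟩
  · exact (h₁ N n).trans (by gcongr; exact le_max_left _ _)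
  · rw [wpInt_neg_natCast, ← mul_assoc a, norm_mul, norm_pow, mul_assoc q, norm_mul, mul_pow,
      mul_left_comm]
    have := h₂ N n
    gcongr
    exact this.trans (by gcongr; exact le_max_right _ _)

theorem wpInt_add_one {q a y : ℂ} (hq : q ≠ 0) (ha : a ≠ 0) (h : WpAdmissible q a y) (n : ℤ) :
    wpInt q a y (n + 1) * (1 - a * q * y * q ^ n) = wpInt q a y n * (y - q ^ n) := by
  obtain ⟨m, rfl | rfl⟩ := n.eq_nat_or_neg
  · rw [← Nat.cast_succ, wpInt_natCast, wpInt_natCast, wpNat_succ, zpow_natCast, mul_assoc,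
      div_mul_cancel₀ _ (h.1 m)]
  · cases m with
    | zero =>
      have h0 := h.1 0
      rw [pow_zero, mul_one] at h0
      change wpNat q a y 1 * _ = wpNat q a y 0 * _
      simp only [wpNat_succ, wpNat_zero, Nat.cast_zero, neg_zero, zpow_zero, pow_zero, mul_one,
        one_mul, div_mul_cancel₀ _ h0]
    | succ m =>
      have e : (-((m + 1 : ℕ) : ℤ)) + 1 = -(m : ℤ) := by push_cast; ring
      have h2 := (h.inv ha).1 m
      rw [e, wpInt_neg_natCast, wpInt_neg_natCast, wpNat_succ, zpow_neg, zpow_natCast]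
      have h3 : y - (q ^ (m + 1))⁻¹ = -(1 - a⁻¹ * q * (a * y) * q ^ m) / q ^ (m + 1) := by
        field_simp; ring
      have h4 : 1 - a * q * y * (q ^ (m + 1))⁻¹ = -(a * y - q ^ m) / q ^ m := by
        field_simp; ring
      rw [h3, h4]
      generalize 1 - a⁻¹ * q * (a * y) * q ^ m = D at h2 ⊢
      generalize a * y - q ^ m = A
      field_simp

theorem wpNat_mul_q {q a y : ℂ} (hq : q ≠ 0) (h : ∀ j : ℕ, 1 - a * q * y * q ^ j ≠ 0) (n : ℕ) :
    wpNat q a y n * ((y - q⁻¹) * (1 - a * q * y)) * q ^ n =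
      wpNat q a (y * q) n * ((y - q ^ n * q⁻¹) * (1 - a * q * y * q ^ n)) := by
  induction n with
  | zero => simp [wpNat]
  | succ n ih =>
    have h1 := h n
    have h2 := h (n + 1)
    have h3 : y * q - q ^ n = (y - q ^ n * q⁻¹) * q := by field_simp
    have h4 : 1 - a * q * (y * q) * q ^ n = 1 - a * q * y * q ^ (n + 1) := by ring
    have h5 : q ^ (n + 1) * q⁻¹ = q ^ n := by rw [pow_succ, mul_inv_cancel_right₀ hq]
    rw [wpNat_succ, wpNat_succ, h3, h4, h5]
    generalize 1 - a * q * y * q ^ (n + 1) = E at h2 ⊢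
    generalize 1 - a * q * y * q ^ n = D at h1 ih ⊢
    generalize y - q ^ n * q⁻¹ = F at ih ⊢
    generalize (y - q⁻¹) * (1 - a * q * y) = K at ih ⊢
    rw [pow_succ]
    generalize y - q ^ n = A
    generalize wpNat q a y n = U at ih ⊢
    generalize wpNat q a (y * q) n = V at ih ⊢
    field_simp
    linear_combination A * ih

theorem wpInt_mul_q {q a y : ℂ} (hq : q ≠ 0) (ha : a ≠ 0) (h : WpAdmissible q a y) (n : ℤ) :
    wpInt q a y n * ((y - q⁻¹) * (1 - a * q * y)) * q ^ n =
      wpInt q a (y * q) n * ((y - q ^ n * q⁻¹) * (1 - a * q * y * q ^ n)) := by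
  obtain ⟨m, rfl | rfl⟩ := n.eq_nat_or_neg
  · exact wpNat_mul_q hq h.1 m
  · have h1 := wpNat_mul_q hq (h.inv ha).1 m
    rw [wpInt_neg_natCast, wpInt_neg_natCast, zpow_neg, zpow_natCast, ← mul_assoc a]
    have h3 : a⁻¹ * q * (a * y) = q * y := by field_simp
    have h4 : (a * y - q⁻¹) * (1 - q * y) = (y - q⁻¹) * (1 - a * q * y) := by field_simp; ring
    have h5 : (y - (q ^ m)⁻¹ * q⁻¹) * (1 - a * q * y * (q ^ m)⁻¹) =
        (a * y - q ^ m * q⁻¹) * (1 - q * y * q ^ m) / (q ^ m * q ^ m) := by field_simp; ring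
    rw [h3, h4] at h1
    rw [h5]
    generalize (a * y - q ^ m * q⁻¹) * (1 - q * y * q ^ m) = A at h1 ⊢
    generalize (y - q⁻¹) * (1 - a * q * y) = K at h1 ⊢
    generalize wpNat q a⁻¹ (a * y) m = U at h1 ⊢
    generalize wpNat q a⁻¹ (a * y * q) m = V at h1 ⊢
    field_simp
    linear_combination h1
/-- The sequences `u N` are bounded, uniformly in `N`, by a multiple of `r ^ n` at `n : ℕ` and of
`s ^ n` at `-n`. -/
def GeomBound (u : ℕ → ℤ → ℂ) (r s : ℝ) : Prop :=
  ∃ C : ℝ, ∀ N n : ℕ, ‖u N n‖ ≤ C * r ^ n ∧ ‖u N (-n)‖ ≤ C * s ^ n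

theorem GeomBound.mul {u v : ℕ → ℤ → ℂ} {r s r' s' : ℝ} (hu : GeomBound u r s)
    (hv : GeomBound v r' s') : GeomBound (fun N n => u N n * v N n) (r * r') (s * s') := by
  obtain ⟨C, hC⟩ := hu
  obtain ⟨D, hD⟩ := hv
  refine ⟨C * D, fun N n => ⟨?_, ?_⟩⟩
  · rw [norm_mul, mul_pow, mul_mul_mul_comm]
    exact mul_le_mul (hC N n).1 (hD N n).1 (norm_nonneg _) ((norm_nonneg _).trans (hC N n).1)
  · rw [norm_mul, mul_pow, mul_mul_mul_comm]
    exact mul_le_mul (hC N n).2 (hD N n).2 (norm_nonneg _) ((norm_nonneg _).trans (hC N n).2)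

theorem geomBound_zpow (x : ℂ) : GeomBound (fun _ n => x ^ n) ‖x‖ ‖x‖⁻¹ :=
  ⟨1, fun N n => ⟨by simp, by simp⟩⟩

theorem geomBound_one_sub {q : ℂ} (hq0 : q ≠ 0) (hq : ‖q‖ < 1) (c : ℂ) :
    GeomBound (fun _ n => 1 - c * q ^ n) 1 ‖q‖⁻¹ := by
  have hq' : 0 < ‖q‖ := norm_pos_iff.2 hq0
  refine ⟨1 + ‖c‖, fun N n => ⟨?_, ?_⟩⟩
  · refine (norm_sub_le _ _).trans ?_
    rw [norm_one, norm_mul, zpow_natCast, norm_pow, one_pow, mul_one]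
    gcongr
    exact mul_le_of_le_one_right (norm_nonneg _) (pow_le_one₀ hq'.le hq.le)
  · refine (norm_sub_le _ _).trans ?_
    rw [norm_one, norm_mul, zpow_neg, zpow_natCast, norm_inv, norm_pow, add_mul, inv_pow, one_mul]
    gcongr
    exact (one_le_inv₀ (pow_pos hq' n)).2 (pow_le_one₀ hq'.le hq.le)

theorem geomBound_wpInt {q a y : ℂ} (hq : ‖q‖ < 1) (ha : a ≠ 0) (hy : y ≠ 0)
    (h : WpAdmissible q a y) :
    GeomBound (fun N n => wpInt q a (y * q ^ N) n) ‖y‖ ‖q * a * y‖ := by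
  obtain ⟨C, -, hC⟩ := exists_norm_wpInt_le hq ha hy h
  exact ⟨C, hC⟩

theorem GeomBound.const {u : ℕ → ℤ → ℂ} {r s : ℝ} (hu : GeomBound u r s) :
    GeomBound (fun _ => u 0) r s := by
  obtain ⟨C, hC⟩ := hu
  exact ⟨C, fun _ => hC 0⟩

theorem GeomBound.exists_summable_bound {u : ℕ → ℤ → ℂ} {r : ℝ} (hu : GeomBound u r r)
    (hr0 : 0 ≤ r) (hr : r < 1) :
    ∃ B : ℤ → ℝ, Summable B ∧ ∀ N n, ‖u N n‖ ≤ B n := by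
  obtain ⟨C, hC⟩ := hu
  refine ⟨fun n => C * r ^ n.natAbs, Summable.mul_left _ (Summable.of_nat_of_neg ?_ ?_),
    fun N n => ?_⟩
  · simpa using summable_geometric_of_lt_one hr0 hr
  · simpa using summable_geometric_of_lt_one hr0 hr
  · obtain ⟨m, rfl | rfl⟩ := n.eq_nat_or_neg
    · simpa using (hC N m).1
    · simpa using (hC N m).2

theorem GeomBound.summable {u : ℕ → ℤ → ℂ} {r : ℝ} (hu : GeomBound u r r)
    (hr0 : 0 ≤ r) (hr : r < 1) (N : ℕ) : Summable (u N) := by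
  obtain ⟨B, hB, h⟩ := hu.exists_summable_bound hr0 hr
  exact hB.of_norm_bounded (h N)

/-- The very-well-poised bilateral term with parameters `1/y₁, …, 1/y₄`, times `1 - a`. -/
noncomputable def vwpTerm (q a y₁ y₂ y₃ y₄ : ℂ) (n : ℤ) : ℂ :=
  (1 - a * (q ^ 2) ^ n) *
    (wpInt q a y₁ n * (wpInt q a y₂ n * (wpInt q a y₃ n * wpInt q a y₄ n))) * (a ^ 2 * q) ^ n

theorem geomBound_vwpTerm {q a y₁ y₂ y₃ y₄ : ℂ} (hq0 : q ≠ 0) (hq : ‖q‖ < 1) (ha : a ≠ 0)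
    (hy₁ : y₁ ≠ 0) (hy₂ : y₂ ≠ 0) (hy₃ : y₃ ≠ 0) (hy₄ : y₄ ≠ 0)
    (h₁ : WpAdmissible q a y₁) (h₂ : WpAdmissible q a y₂) (h₃ : WpAdmissible q a y₃)
    (h₄ : WpAdmissible q a y₄) :
    GeomBound (fun N => vwpTerm q a (y₁ * q ^ N) (y₂ * q ^ N) (y₃ * q ^ N) (y₄ * q ^ N))
      ‖a ^ 2 * q * (y₁ * y₂ * y₃ * y₄)‖ ‖a ^ 2 * q * (y₁ * y₂ * y₃ * y₄)‖ := by
  have hq2 : ‖q ^ 2‖ < 1 := by rw [norm_pow]; exact pow_lt_one₀ (norm_nonneg _) hq two_ne_zero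
  have := ((geomBound_one_sub (pow_ne_zero 2 hq0) hq2 a).mul
    ((geomBound_wpInt hq ha hy₁ h₁).mul ((geomBound_wpInt hq ha hy₂ h₂).mul
      ((geomBound_wpInt hq ha hy₃ h₃).mul (geomBound_wpInt hq ha hy₄ h₄))))).mul
    (geomBound_zpow (a ^ 2 * q))
  have hq' := norm_ne_zero_iff.2 hq0
  have ha' := norm_ne_zero_iff.2 ha
  convert this using 1
  · rfl
  · simp only [norm_mul, norm_pow]; ring
  · simp only [norm_mul, norm_pow]; field_simp

theorem summable_vwpTerm {q a y₁ y₂ y₃ y₄ : ℂ} (hq0 : q ≠ 0) (hq : ‖q‖ < 1) (ha : a ≠ 0)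
    (hy₁ : y₁ ≠ 0) (hy₂ : y₂ ≠ 0) (hy₃ : y₃ ≠ 0) (hy₄ : y₄ ≠ 0)
    (h₁ : WpAdmissible q a y₁) (h₂ : WpAdmissible q a y₂) (h₃ : WpAdmissible q a y₃)
    (h₄ : WpAdmissible q a y₄) (hz : ‖a ^ 2 * q * (y₁ * y₂ * y₃ * y₄)‖ < 1) :
    Summable (vwpTerm q a y₁ y₂ y₃ y₄) := by
  simpa using (geomBound_vwpTerm hq0 hq ha hy₁ hy₂ hy₃ hy₄ h₁ h₂ h₃ h₄).summable
    (norm_nonneg _) hz 0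

/-- The certificate whose difference telescopes the contiguous relation for `vwpTerm`. -/
noncomputable def vwpCert (q a y₁ y₂ y₃ y₄ : ℂ) (n : ℤ) : ℂ :=
  q⁻¹ ^ n * (wpInt q a (y₁ * q) n * (1 - a * q * y₁ * q ^ n)) *
    ((wpInt q a y₂ n * (1 - a * y₂ * q ^ n)) *
      ((wpInt q a y₃ n * (1 - a * y₃ * q ^ n)) * (wpInt q a y₄ n * (1 - a * y₄ * q ^ n)))) *
    (a ^ 2 * q) ^ n

theorem summable_vwpCert {q a y₁ y₂ y₃ y₄ : ℂ} (hq0 : q ≠ 0) (hq : ‖q‖ < 1) (ha : a ≠ 0)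
    (hy₁ : y₁ ≠ 0) (hy₂ : y₂ ≠ 0) (hy₃ : y₃ ≠ 0) (hy₄ : y₄ ≠ 0)
    (h₁ : WpAdmissible q a y₁) (h₂ : WpAdmissible q a y₂) (h₃ : WpAdmissible q a y₃)
    (h₄ : WpAdmissible q a y₄) (hz : ‖a ^ 2 * q * (y₁ * y₂ * y₃ * y₄)‖ < 1) :
    Summable (vwpCert q a y₁ y₂ y₃ y₄) := by
  have h₁' : WpAdmissible q a (y₁ * q) := by simpa using h₁.mul_pow 1
  have hB {y : ℂ} (hy : y ≠ 0) (h : WpAdmissible q a y) (c : ℂ) :=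
    (geomBound_wpInt hq ha hy h).mul (geomBound_one_sub hq0 hq c)
  have := (((geomBound_zpow q⁻¹).mul (hB (mul_ne_zero hy₁ hq0) h₁' (a * q * y₁))).mul
    ((hB hy₂ h₂ (a * y₂)).mul ((hB hy₃ h₃ (a * y₃)).mul (hB hy₄ h₄ (a * y₄))))).mul
    (geomBound_zpow (a ^ 2 * q))
  have hq' := norm_ne_zero_iff.2 hq0
  have ha' := norm_ne_zero_iff.2 ha
  have key : GeomBound (fun N => vwpCert q a y₁ y₂ y₃ y₄) ‖a ^ 2 * q * (y₁ * y₂ * y₃ * y₄)‖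
      ‖a ^ 2 * q * (y₁ * y₂ * y₃ * y₄)‖ := by
    convert this.const using 1
    · simp only [pow_zero, mul_one]; rfl
    · simp only [norm_mul, norm_pow, norm_inv]; field_simp
    · simp only [norm_mul, norm_pow, norm_inv]; field_simp
  exact key.summable (norm_nonneg _) hz 0

theorem vwpTerm_sub_eq_vwpCert_sub {q a y₁ y₂ y₃ y₄ : ℂ} (hq0 : q ≠ 0) (ha : a ≠ 0)
    (h₁ : WpAdmissible q a y₁) (h₂ : WpAdmissible q a y₂) (h₃ : WpAdmissible q a y₃)
    (h₄ : WpAdmissible q a y₄) (n : ℤ) :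
    vwpTerm q a y₁ y₂ y₃ y₄ n *
        ((1 - a * q * y₁) * (1 - q * y₁) * (1 - a ^ 2 * q * (y₁ * y₂ * y₃ * y₄))) -
      vwpTerm q a (y₁ * q) y₂ y₃ y₄ n * ((1 - a * q * (y₁ * y₂)) * (1 - a * q * (y₁ * y₃)) *
        (1 - a * q * (y₁ * y₄))) =
      q * y₁ * (vwpCert q a y₁ y₂ y₃ y₄ (n + 1) - vwpCert q a y₁ y₂ y₃ y₄ n) := by
  have h₁' : WpAdmissible q a (y₁ * q) := by simpa using h₁.mul_pow 1
  have e1 := wpInt_mul_q hq0 ha h₁ n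
  have s1 := wpInt_add_one hq0 ha h₁' n
  have s2 := wpInt_add_one hq0 ha h₂ n
  have s3 := wpInt_add_one hq0 ha h₃ n
  have s4 := wpInt_add_one hq0 ha h₄ n
  have haq : a ^ 2 * q ≠ 0 := mul_ne_zero (pow_ne_zero 2 ha) hq0
  have hx : q ^ n ≠ 0 := zpow_ne_zero n hq0
  have hsq : (q ^ 2) ^ n = q ^ n * q ^ n := by rw [sq, mul_zpow]
  have hC : vwpCert q a y₁ y₂ y₃ y₄ (n + 1) = (q ^ n)⁻¹ * q⁻¹ *
      (wpInt q a (y₁ * q) n * (y₁ * q - q ^ n)) * ((wpInt q a y₂ n * (y₂ - q ^ n)) *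
      ((wpInt q a y₃ n * (y₃ - q ^ n)) * (wpInt q a y₄ n * (y₄ - q ^ n)))) *
      ((a ^ 2 * q) ^ n * (a ^ 2 * q)) := by
    rw [vwpCert, zpow_add_one₀ (inv_ne_zero hq0), zpow_add_one₀ hq0, zpow_add_one₀ haq, ← s1,
      ← s2, ← s3, ← s4, inv_zpow]
    ring
  rw [hC, vwpCert, vwpTerm, vwpTerm, hsq, inv_zpow]
  generalize wpInt q a (y₁ * q) n = V at e1 ⊢
  generalize wpInt q a y₁ n = U at e1 ⊢
  generalize wpInt q a y₂ n = W₂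
  generalize wpInt q a y₃ n = W₃
  generalize wpInt q a y₄ n = W₄
  generalize (a ^ 2 * q) ^ n = Z
  generalize q ^ n = x at e1 hx ⊢
  field_simp at e1 ⊢
  linear_combination
    (-(1 - a * x ^ 2) * W₂ * W₃ * W₄ * Z * (1 - a ^ 2 * q * (y₁ * y₂ * y₃ * y₄))) * e1

theorem tsum_vwpTerm_contiguous {q a y₁ y₂ y₃ y₄ : ℂ} (hq0 : q ≠ 0) (hq : ‖q‖ < 1) (ha : a ≠ 0)
    (hy₁ : y₁ ≠ 0) (hy₂ : y₂ ≠ 0) (hy₃ : y₃ ≠ 0) (hy₄ : y₄ ≠ 0)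
    (h₁ : WpAdmissible q a y₁) (h₂ : WpAdmissible q a y₂) (h₃ : WpAdmissible q a y₃)
    (h₄ : WpAdmissible q a y₄) (hz : ‖a ^ 2 * q * (y₁ * y₂ * y₃ * y₄)‖ < 1) :
    (∑' n, vwpTerm q a y₁ y₂ y₃ y₄ n) *
        ((1 - a * q * y₁) * (1 - q * y₁) * (1 - a ^ 2 * q * (y₁ * y₂ * y₃ * y₄))) =
      (∑' n, vwpTerm q a (y₁ * q) y₂ y₃ y₄ n) * ((1 - a * q * (y₁ * y₂)) *
        (1 - a * q * (y₁ * y₃)) * (1 - a * q * (y₁ * y₄))) := by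
  have h₁' : WpAdmissible q a (y₁ * q) := by simpa using h₁.mul_pow 1
  have hz' : ‖a ^ 2 * q * (y₁ * q * y₂ * y₃ * y₄)‖ < 1 := by
    rw [show a ^ 2 * q * (y₁ * q * y₂ * y₃ * y₄) = a ^ 2 * q * (y₁ * y₂ * y₃ * y₄) * q by ring,
      norm_mul]
    exact mul_lt_one_of_nonneg_of_lt_one_left (norm_nonneg _) hz hq.le
  have t := (summable_vwpTerm hq0 hq ha hy₁ hy₂ hy₃ hy₄ h₁ h₂ h₃ h₄ hz).hasSum
  have t' := (summable_vwpTerm hq0 hq ha (mul_ne_zero hy₁ hq0) hy₂ hy₃ hy₄ h₁' h₂ h₃ h₄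
    hz').hasSum
  have g := (summable_vwpCert hq0 hq ha hy₁ hy₂ hy₃ hy₄ h₁ h₂ h₃ h₄ hz).hasSum
  have g' := (Equiv.addRight (1 : ℤ)).hasSum_iff.2 g
  have l := (t.mul_right ((1 - a * q * y₁) * (1 - q * y₁) *
    (1 - a ^ 2 * q * (y₁ * y₂ * y₃ * y₄)))).sub (t'.mul_right ((1 - a * q * (y₁ * y₂)) *
        (1 - a * q * (y₁ * y₃)) * (1 - a * q * (y₁ * y₄))))
  have r := (g'.sub g).mul_left (q * y₁)
  have hfun := funext (vwpTerm_sub_eq_vwpCert_sub hq0 ha h₁ h₂ h₃ h₄)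
  rw [hfun] at l
  have := l.unique r
  rwa [sub_self, mul_zero, sub_eq_zero] at this
theorem norm_mul_pow_lt_one {q x : ℂ} (hq : ‖q‖ < 1) (hx : ‖x‖ < 1) (N : ℕ) :
    ‖x * q ^ N‖ < 1 := by
  rw [norm_mul, norm_pow]
  exact mul_lt_one_of_nonneg_of_lt_one_left (norm_nonneg _) hx (pow_le_one₀ (norm_nonneg _) hq.le)

theorem one_sub_mul_pow_ne_zero {q x : ℂ} (hq : ‖q‖ < 1) (hx : ‖x‖ < 1) (j : ℕ) :
    1 - x * q ^ j ≠ 0 := by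
  intro h
  have := norm_mul_pow_lt_one hq hx j
  rw [← sub_eq_zero.1 h, norm_one] at this
  exact this.false

theorem vwpTerm_rotate (q a y₁ y₂ y₃ y₄ : ℂ) :
    vwpTerm q a y₁ y₂ y₃ y₄ = vwpTerm q a y₂ y₃ y₄ y₁ := by
  funext n
  simp only [vwpTerm]
  ring

theorem tsum_vwpTerm_shift {q a y₁ y₂ y₃ y₄ : ℂ} (hq0 : q ≠ 0) (hq : ‖q‖ < 1) (ha : a ≠ 0)
    (hy₁ : y₁ ≠ 0) (hy₂ : y₂ ≠ 0) (hy₃ : y₃ ≠ 0) (hy₄ : y₄ ≠ 0)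
    (h₁ : WpAdmissible q a y₁) (h₂ : WpAdmissible q a y₂) (h₃ : WpAdmissible q a y₃)
    (h₄ : WpAdmissible q a y₄) (hz : ‖a ^ 2 * q * (y₁ * y₂ * y₃ * y₄)‖ < 1) (N : ℕ) :
    (∑' n, vwpTerm q a y₁ y₂ y₃ y₄ n) * (qPochFin q (a * q * y₁) N * qPochFin q (q * y₁) N *
        qPochFin q (a ^ 2 * q * (y₁ * y₂ * y₃ * y₄)) N) =
      (∑' n, vwpTerm q a y₂ y₃ y₄ (y₁ * q ^ N) n) * (qPochFin q (a * q * (y₁ * y₂)) N *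
        qPochFin q (a * q * (y₁ * y₃)) N * qPochFin q (a * q * (y₁ * y₄)) N) := by
  rw [← vwpTerm_rotate q a (y₁ * q ^ N)]
  induction N with
  | zero => simp [qPochFin]
  | succ N ih =>
    have hs (x : ℂ) : qPochFin q x (N + 1) = qPochFin q x N * (1 - x * q ^ N) :=
      prod_range_succ _ _
    have ez : a ^ 2 * q * (y₁ * q ^ N * y₂ * y₃ * y₄) =
      a ^ 2 * q * (y₁ * y₂ * y₃ * y₄) * q ^ N := by ring
    have step := tsum_vwpTerm_contiguous hq0 hq ha (mul_ne_zero hy₁ (pow_ne_zero N hq0)) hy₂ hy₃ hy₄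
      (h₁.mul_pow N) h₂ h₃ h₄ (by rw [ez]; exact norm_mul_pow_lt_one hq hz N)
    rw [ez, mul_assoc y₁ (q ^ N) q, ← pow_succ] at step
    simp only [hs]
    linear_combination ((1 - a * q * y₁ * q ^ N) * (1 - q * y₁ * q ^ N) *
      (1 - a ^ 2 * q * (y₁ * y₂ * y₃ * y₄) * q ^ N)) * ih + (qPochFin q (a * q * (y₁ * y₂)) N *
        qPochFin q (a * q * (y₁ * y₃)) N * qPochFin q (a * q * (y₁ * y₄)) N) * step

theorem tsum_vwpTerm_shift_all {q a y₁ y₂ y₃ y₄ : ℂ} (hq0 : q ≠ 0) (hq : ‖q‖ < 1) (ha : a ≠ 0)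
    (hy₁ : y₁ ≠ 0) (hy₂ : y₂ ≠ 0) (hy₃ : y₃ ≠ 0) (hy₄ : y₄ ≠ 0)
    (h₁ : WpAdmissible q a y₁) (h₂ : WpAdmissible q a y₂) (h₃ : WpAdmissible q a y₃)
    (h₄ : WpAdmissible q a y₄) (hz : ‖a ^ 2 * q * (y₁ * y₂ * y₃ * y₄)‖ < 1) (N : ℕ) :
    (∑' n, vwpTerm q a y₁ y₂ y₃ y₄ n) *
      ((qPochFin q (a * q * y₁) N * qPochFin q (q * y₁) N) *
        (qPochFin q (a * q * y₂) N * qPochFin q (q * y₂) N) *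
        (qPochFin q (a * q * y₃) N * qPochFin q (q * y₃) N) *
        (qPochFin q (a * q * y₄) N * qPochFin q (q * y₄) N) *
        qPochFin q (a ^ 2 * q * (y₁ * y₂ * y₃ * y₄)) (N + N + N + N)) =
      (∑' n, vwpTerm q a (y₁ * q ^ N) (y₂ * q ^ N) (y₃ * q ^ N) (y₄ * q ^ N) n) *
      (qPochFin q (a * q * (y₁ * y₂)) (N + N) * qPochFin q (a * q * (y₁ * y₃)) (N + N) *
        qPochFin q (a * q * (y₁ * y₄)) (N + N) * qPochFin q (a * q * (y₂ * y₃)) (N + N) *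
        qPochFin q (a * q * (y₂ * y₄)) (N + N) * qPochFin q (a * q * (y₃ * y₄)) (N + N)) := by
  have hy {y : ℂ} (h : y ≠ 0) : y * q ^ N ≠ 0 := mul_ne_zero h (pow_ne_zero N hq0)
  set z := a ^ 2 * q * (y₁ * y₂ * y₃ * y₄) with z_def
  have hz2 : a ^ 2 * q * (y₂ * y₃ * y₄ * (y₁ * q ^ N)) = z * q ^ N := by rw [z_def]; ring
  have hz3 : a ^ 2 * q * (y₃ * y₄ * (y₁ * q ^ N) * (y₂ * q ^ N)) = z * q ^ (N + N) := by
    rw [z_def]; ring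
  have hz4 : a ^ 2 * q * (y₄ * (y₁ * q ^ N) * (y₂ * q ^ N) * (y₃ * q ^ N)) =
      z * q ^ (N + N + N) := by rw [z_def]; ring
  have hp (u v : ℂ) : a * q * (v * (u * q ^ N)) = a * q * (u * v) * q ^ N := by ring
  have s1 := tsum_vwpTerm_shift hq0 hq ha hy₁ hy₂ hy₃ hy₄ h₁ h₂ h₃ h₄ hz N
  have s2 := tsum_vwpTerm_shift hq0 hq ha hy₂ hy₃ hy₄ (hy hy₁) h₂ h₃ h₄ (h₁.mul_pow N)
    (by rw [hz2]; exact norm_mul_pow_lt_one hq hz _) N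
  have s3 := tsum_vwpTerm_shift hq0 hq ha hy₃ hy₄ (hy hy₁) (hy hy₂) h₃ h₄ (h₁.mul_pow N)
    (h₂.mul_pow N) (by rw [hz3]; exact norm_mul_pow_lt_one hq hz _) N
  have s4 := tsum_vwpTerm_shift hq0 hq ha hy₄ (hy hy₁) (hy hy₂) (hy hy₃) h₄ (h₁.mul_pow N)
    (h₂.mul_pow N) (h₃.mul_pow N) (by rw [hz4]; exact norm_mul_pow_lt_one hq hz _) N
  rw [← z_def] at s1
  rw [hz2, hp] at s2
  rw [hz3, hp, hp] at s3
  rw [hz4, hp, hp, hp] at s4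
  simp only [qPochFin_add q z, qPochFin_add q (a * q * (_ * _)) N N]
  generalize (∑' n, vwpTerm q a y₁ y₂ y₃ y₄ n) = S₀ at *
  generalize (∑' n, vwpTerm q a y₂ y₃ y₄ (y₁ * q ^ N) n) = S₁ at *
  generalize (∑' n, vwpTerm q a y₃ y₄ (y₁ * q ^ N) (y₂ * q ^ N) n) = S₂ at *
  generalize (∑' n, vwpTerm q a y₄ (y₁ * q ^ N) (y₂ * q ^ N) (y₃ * q ^ N) n) = S₃ at *
  generalize (∑' n, vwpTerm q a (y₁ * q ^ N) (y₂ * q ^ N) (y₃ * q ^ N) (y₄ * q ^ N) n) = S₄ at *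
  generalize qPochFin q (a * q * y₁) N * qPochFin q (q * y₁) N = D₁ at *
  generalize qPochFin q (a * q * y₂) N * qPochFin q (q * y₂) N = D₂ at *
  generalize qPochFin q (a * q * y₃) N * qPochFin q (q * y₃) N = D₃ at *
  generalize qPochFin q (a * q * y₄) N * qPochFin q (q * y₄) N = D₄ at *
  calc _ = (S₀ * (D₁ * qPochFin q z N)) * (D₂ * qPochFin q (z * q ^ N) N) *
        (D₃ * qPochFin q (z * q ^ (N + N)) N) * (D₄ * qPochFin q (z * q ^ (N + N + N)) N) := by ring
    _ = (S₁ * (D₂ * qPochFin q (z * q ^ N) N)) *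
        (D₃ * qPochFin q (z * q ^ (N + N)) N) * (D₄ * qPochFin q (z * q ^ (N + N + N)) N) *
        (qPochFin q (a * q * (y₁ * y₂)) N *
        qPochFin q (a * q * (y₁ * y₃)) N * qPochFin q (a * q * (y₁ * y₄)) N) := by rw [s1]; ring
    _ = (S₂ * (D₃ * qPochFin q (z * q ^ (N + N)) N)) *
        (D₄ * qPochFin q (z * q ^ (N + N + N)) N) *
        (qPochFin q (a * q * (y₁ * y₂)) N *
        qPochFin q (a * q * (y₁ * y₃)) N * qPochFin q (a * q * (y₁ * y₄)) N) *
        (qPochFin q (a * q * (y₂ * y₃)) N * qPochFin q (a * q * (y₂ * y₄)) N *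
          qPochFin q (a * q * (y₁ * y₂) * q ^ N) N) := by rw [s2]; ring
    _ = (S₃ * (D₄ * qPochFin q (z * q ^ (N + N + N)) N)) *
        (qPochFin q (a * q * (y₁ * y₂)) N *
        qPochFin q (a * q * (y₁ * y₃)) N * qPochFin q (a * q * (y₁ * y₄)) N) *
        (qPochFin q (a * q * (y₂ * y₃)) N * qPochFin q (a * q * (y₂ * y₄)) N *
          qPochFin q (a * q * (y₁ * y₂) * q ^ N) N) * (qPochFin q (a * q * (y₃ * y₄)) N *
          qPochFin q (a * q * (y₁ * y₃) * q ^ N) N * qPochFin q (a * q * (y₂ * y₃) * q ^ N) N) := by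
      rw [s3]; ring
    _ = _ := by rw [s4]; ring

theorem continuousAt_wpNat_zero (q a : ℂ) (n : ℕ) : ContinuousAt (fun y => wpNat q a y n) 0 := by
  simp only [wpNat]
  refine tendsto_finsetProd _ fun j _ => ?_
  exact ContinuousAt.div (by fun_prop) (by fun_prop) (by simp)

theorem continuousAt_wpInt_zero (q a : ℂ) (n : ℤ) : ContinuousAt (fun y => wpInt q a y n) 0 := by
  cases n with
  | ofNat n => exact continuousAt_wpNat_zero q a n
  | negSucc n =>
    refine continuousAt_const.mul ?_
    have h : ContinuousAt (fun y => wpNat q a⁻¹ y (n + 1)) (a * 0) := by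
      rw [mul_zero]; exact continuousAt_wpNat_zero q a⁻¹ _
    exact h.comp (f := fun y => a * y) (by fun_prop)

theorem tendsto_tsum_vwpTerm {q a y₁ y₂ y₃ y₄ : ℂ} (hq0 : q ≠ 0) (hq : ‖q‖ < 1) (ha : a ≠ 0)
    (hy₁ : y₁ ≠ 0) (hy₂ : y₂ ≠ 0) (hy₃ : y₃ ≠ 0) (hy₄ : y₄ ≠ 0)
    (h₁ : WpAdmissible q a y₁) (h₂ : WpAdmissible q a y₂) (h₃ : WpAdmissible q a y₃)
    (h₄ : WpAdmissible q a y₄) (hz : ‖a ^ 2 * q * (y₁ * y₂ * y₃ * y₄)‖ < 1) :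
    Tendsto (fun N : ℕ =>
      ∑' n, vwpTerm q a (y₁ * q ^ N) (y₂ * q ^ N) (y₃ * q ^ N) (y₄ * q ^ N) n) atTop
      (𝓝 (∑' n, vwpTerm q a 0 0 0 0 n)) := by
  obtain ⟨B, hB, hle⟩ := (geomBound_vwpTerm hq0 hq ha hy₁ hy₂ hy₃ hy₄ h₁ h₂ h₃
    h₄).exists_summable_bound (norm_nonneg _) hz
  refine tendsto_tsum_of_dominated_convergence hB (fun n => ?_) (Eventually.of_forall hle)
  have hl (y : ℂ) : Tendsto (fun N : ℕ => wpInt q a (y * q ^ N) n) atTop (𝓝 (wpInt q a 0 n)) := by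
    refine (continuousAt_wpInt_zero q a n).tendsto.comp ?_
    simpa using (tendsto_pow_atTop_nhds_zero_of_norm_lt_one hq).const_mul y
  exact (((hl y₁).mul ((hl y₂).mul ((hl y₃).mul (hl y₄)))).const_mul _).mul_const _

theorem tsum_vwpTerm_mul_eq {q a y₁ y₂ y₃ y₄ : ℂ} (hq0 : q ≠ 0) (hq : ‖q‖ < 1) (ha : a ≠ 0)
    (hy₁ : y₁ ≠ 0) (hy₂ : y₂ ≠ 0) (hy₃ : y₃ ≠ 0) (hy₄ : y₄ ≠ 0)
    (h₁ : WpAdmissible q a y₁) (h₂ : WpAdmissible q a y₂) (h₃ : WpAdmissible q a y₃)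
    (h₄ : WpAdmissible q a y₄) (hz : ‖a ^ 2 * q * (y₁ * y₂ * y₃ * y₄)‖ < 1) :
    (∑' n, vwpTerm q a y₁ y₂ y₃ y₄ n) *
      ((qPochInf q (a * q * y₁) * qPochInf q (q * y₁)) *
        (qPochInf q (a * q * y₂) * qPochInf q (q * y₂)) *
        (qPochInf q (a * q * y₃) * qPochInf q (q * y₃)) *
        (qPochInf q (a * q * y₄) * qPochInf q (q * y₄)) *
        qPochInf q (a ^ 2 * q * (y₁ * y₂ * y₃ * y₄))) =
      (∑' n, vwpTerm q a 0 0 0 0 n) *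
      (qPochInf q (a * q * (y₁ * y₂)) * qPochInf q (a * q * (y₁ * y₃)) *
        qPochInf q (a * q * (y₁ * y₄)) * qPochInf q (a * q * (y₂ * y₃)) *
        qPochInf q (a * q * (y₂ * y₄)) * qPochInf q (a * q * (y₃ * y₄))) := by
  have f (x : ℂ) := tendsto_qPochFin hq x
  have d : Tendsto (fun N : ℕ => N + N) atTop atTop :=
    tendsto_id.atTop_add_atTop tendsto_id
  have f₂ (x : ℂ) := (f x).comp d
  have f₄ (x : ℂ) := (f x).comp ((d.atTop_add_atTop tendsto_id).atTop_add_atTop tendsto_id)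
  refine tendsto_nhds_unique (((((((f _).mul (f _)).mul ((f _).mul (f _))).mul
    ((f _).mul (f _))).mul ((f _).mul (f _))).mul (f₄ _)).const_mul _) ?_
  refine Tendsto.congr (fun N =>
    (tsum_vwpTerm_shift_all hq0 hq ha hy₁ hy₂ hy₃ hy₄ h₁ h₂ h₃ h₄ hz N).symm) ?_
  exact (tendsto_tsum_vwpTerm hq0 hq ha hy₁ hy₂ hy₃ hy₄ h₁ h₂ h₃ h₄ hz).mul
    ((((((f₂ _).mul (f₂ _)).mul (f₂ _)).mul (f₂ _)).mul (f₂ _)).mul (f₂ _))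

theorem wpNat_zero_pow_four {q : ℂ} (hq : q ≠ 0) (a : ℂ) (n : ℕ) :
    wpNat q a 0 n ^ 4 = q ^ (2 * (n : ℤ) * (n - 1)) := by
  induction n with
  | zero => simp [wpNat_zero]
  | succ n ih =>
    rw [wpNat_succ, mul_pow, ih]
    have e : 2 * ((n + 1 : ℕ) : ℤ) * ((n + 1 : ℕ) - 1) = 2 * n * (n - 1) + (4 * n : ℕ) := by
      push_cast; ring
    rw [e, zpow_add₀ hq, zpow_natCast]
    congr 1
    simp only [mul_zero, zero_mul, sub_zero, zero_sub, div_one]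
    rw [pow_mul' q 4 n, neg_pow]
    norm_num [pow_mul]

theorem vwpTerm_zero {q : ℂ} (hq : q ≠ 0) (a : ℂ) (n : ℤ) :
    vwpTerm q a 0 0 0 0 n = (1 - a * q ^ (2 * n)) * q ^ (2 * n * (n - 1)) * (a ^ 2 * q) ^ n := by
  have h : wpInt q a 0 n ^ 4 = q ^ (2 * n * (n - 1)) := by
    obtain ⟨m, rfl | rfl⟩ := n.eq_nat_or_neg
    · exact wpNat_zero_pow_four hq a m
    · rw [wpInt_neg_natCast, mul_pow, mul_zero, wpNat_zero_pow_four hq, ← pow_mul, ← zpow_natCast,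
        ← zpow_add₀ hq]
      congr 1
      push_cast; ring
  rw [vwpTerm, ← h, zpow_mul, zpow_ofNat]
  ring

theorem tsum_vwpTerm_zero_zpow {q : ℂ} (hq : q ≠ 0) (k : ℤ) :
    ∑' n, vwpTerm q (q ^ k) 0 0 0 0 n = 0 := by
  have h : ∀ n, vwpTerm q (q ^ k) 0 0 0 0 (-k - n) = -vwpTerm q (q ^ k) 0 0 0 0 n := by
    intro n
    have e (n : ℤ) : vwpTerm q (q ^ k) 0 0 0 0 n =
        q ^ (2 * n * n - n + 2 * k * n) - q ^ (2 * n * n + n + 2 * k * n + k) := by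
      rw [vwpTerm_zero hq, mul_zpow, ← zpow_natCast, ← zpow_mul, ← zpow_mul, mul_assoc,
        ← zpow_add₀ hq, ← zpow_add₀ hq, sub_mul, one_mul, ← zpow_add₀ hq, ← zpow_add₀ hq]
      congr 2 <;> push_cast <;> ring
    rw [e, e, neg_sub]
    congr 2 <;> ring
  have h' := (Equiv.subLeft (-k)).tsum_eq (vwpTerm q (q ^ k) 0 0 0 0)
  simp only [Equiv.subLeft_apply, h, tsum_neg] at h'
  exact self_eq_neg.1 h'.symm

theorem tsum_vwpTerm_one_inv {q a t : ℂ} (ha : a ≠ 0) :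
    ∑' n, vwpTerm q a 1 t t a⁻¹ n = 1 - a := by
  rw [tsum_eq_single 0]
  · have e (y : ℂ) : wpInt q a y 0 = 1 := rfl
    simp [vwpTerm, e]
  · intro n hn
    have h (c : ℂ) (m : ℕ) : wpNat q c 1 (m + 1) = 0 :=
      prod_eq_zero (mem_range.2 m.succ_pos) (by simp)
    cases n with
    | ofNat m =>
      obtain ⟨m, rfl⟩ := Nat.exists_eq_succ_of_ne_zero (show m ≠ 0 by rintro rfl; exact hn rfl)
      have e : wpInt q a 1 (Int.ofNat (m + 1)) = 0 := h a m
      simp only [Nat.succ_eq_add_one, vwpTerm, e, zero_mul, mul_zero]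
    | negSucc m =>
      have e : wpInt q a a⁻¹ (Int.negSucc m) = 0 := by
        rw [wpInt, mul_inv_cancel₀ ha, h, mul_zero]
      simp only [vwpTerm, e, zero_mul, mul_zero]

/-- The Jacobi triple product identity, for the limiting case of the bilateral series. -/
theorem tsum_vwpTerm_zero {q a : ℂ} (hq0 : q ≠ 0) (hq : ‖q‖ < 1) (ha : a ≠ 0) :
    ∑' n, vwpTerm q a 0 0 0 0 n =
      (1 - a) * (qPochInf q q * qPochInf q (a * q) * qPochInf q (q / a)) := by
  by_cases hk : ∃ k : ℤ, a = q ^ k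
  · obtain ⟨k, rfl⟩ := hk
    rw [tsum_vwpTerm_zero_zpow hq0, eq_comm]
    obtain ⟨m, rfl | rfl⟩ := k.eq_nat_or_neg <;> rcases m with _ | m
    · simp
    · rw [qPochInf_eq_zero (x := q / q ^ ((m + 1 : ℕ) : ℤ)) m, mul_zero, mul_zero]
      rw [zpow_natCast, pow_succ]
      field_simp
      ring
    · simp
    · rw [qPochInf_eq_zero (x := q ^ (-((m + 1 : ℕ) : ℤ)) * q) m, mul_zero, zero_mul, mul_zero]
      rw [zpow_neg, zpow_natCast, pow_succ]
      field_simp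
      ring
  · push Not at hk
    set t : ℂ := (((1 + ‖a‖)⁻¹ : ℝ) : ℂ) with t_def
    have ha' := norm_nonneg a
    have nt : ‖t‖ = (1 + ‖a‖)⁻¹ := by
      rw [t_def, Complex.norm_real, Real.norm_of_nonneg (by positivity)]
    have ht0 : t ≠ 0 := by rw [← norm_ne_zero_iff, nt]; positivity
    have ht1 : ‖t‖ ≤ 1 := by rw [nt]; exact inv_le_one_of_one_le₀ (by linarith)
    have hat : ‖a * t‖ < 1 := by
      rw [norm_mul, nt, ← div_eq_mul_inv, div_lt_one (by positivity)]; linarith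
    have l1 : ‖a * q * t‖ < 1 := by
      rw [mul_right_comm, norm_mul]
      exact mul_lt_one_of_nonneg_of_lt_one_left (norm_nonneg _) hat hq.le
    have l2 : ‖q * t‖ < 1 := by
      rw [norm_mul]; exact mul_lt_one_of_nonneg_of_lt_one_left (norm_nonneg _) hq ht1
    have l3 : ‖a * q * (t * t)‖ < 1 := by
      rw [← mul_assoc, norm_mul]
      exact mul_lt_one_of_nonneg_of_lt_one_left (norm_nonneg _) l1 ht1
    have n1 := one_sub_mul_pow_ne_zero hq l1
    have n2 := one_sub_mul_pow_ne_zero hq l2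
    have n3 := one_sub_mul_pow_ne_zero hq l3
    have n4 := one_sub_mul_pow_ne_zero hq hq
    have n5 (j : ℕ) : 1 - a * q * q ^ j ≠ 0 := by
      intro h
      apply hk (-(j + 1 : ℕ))
      rw [zpow_neg, zpow_natCast]
      exact eq_inv_of_mul_eq_one_left (by linear_combination -h)
    have n6 (j : ℕ) : 1 - q * a⁻¹ * q ^ j ≠ 0 := by
      intro h
      apply hk (j + 1 : ℕ)
      rw [zpow_natCast]
      field_simp at h
      linear_combination h
    have ez : a ^ 2 * q * (1 * t * t * a⁻¹) = a * q * (t * t) := by field_simp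
    have ht : WpAdmissible q a t := ⟨n1, n2⟩
    have key := tsum_vwpTerm_mul_eq hq0 hq ha one_ne_zero ht0 ht0 (inv_ne_zero ha)
      ⟨by simpa using n5, by simpa using n4⟩ ht ht
      ⟨by simpa [mul_right_comm _ q, ha] using n4, n6⟩ (by rw [ez]; exact l3)
    have e1 : a * q * a⁻¹ = q := by field_simp
    have e2 : a * q * (t * a⁻¹) = q * t := by field_simp
    rw [tsum_vwpTerm_one_inv ha, ez] at key
    simp only [one_mul, mul_one, e1, e2, ← div_eq_mul_inv q a] at key
    have m1 := qPochInf_ne_zero hq n1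
    have m2 := qPochInf_ne_zero hq n2
    have m3 := qPochInf_ne_zero hq n3
    have m4 := qPochInf_ne_zero hq n4
    refine mul_right_cancel₀ (mul_ne_zero (mul_ne_zero (mul_ne_zero m4 m3) (pow_ne_zero 2 m1))
      (pow_ne_zero 2 m2)) ?_
    linear_combination -key

theorem wpInt_inv {q a b : ℂ} (hq : q ≠ 0) (ha : a ≠ 0) (hb : b ≠ 0) (n : ℤ) :
    wpInt q a b⁻¹ n = qPoch q b n / qPoch q (a * q / b) n * b⁻¹ ^ n := by
  obtain ⟨m, rfl | rfl⟩ := n.eq_nat_or_neg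
  · rw [wpInt_natCast, wpNat, qPoch, qPoch, if_pos (by positivity), if_pos (by positivity),
      Int.toNat_natCast, ← prod_div_distrib, zpow_natCast, ← card_range m, ← prod_const,
      card_range, ← prod_mul_distrib]
    refine prod_congr rfl fun j _ => ?_
    have e : b⁻¹ - q ^ j = (1 - b * q ^ j) * b⁻¹ := by field_simp
    rw [e, div_eq_mul_inv (a * q), div_mul_eq_mul_div]
  · rcases m with _ | m
    · simp [qPoch, wpInt, wpNat]
    · rw [wpInt_neg_natCast, wpNat, qPoch, qPoch, if_neg (by lia), if_neg (by lia), neg_neg,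
        Int.toNat_natCast, zpow_neg, zpow_natCast, div_inv_eq_mul, ← inv_pow, inv_inv,
        mul_comm (∏ j ∈ _, _)⁻¹, ← prod_inv_distrib, ← prod_mul_distrib]
      have hc (x : ℂ) : x ^ (m + 1) = ∏ j ∈ range (m + 1), x := by
        rw [prod_const, card_range]
      rw [hc q, hc b, ← prod_mul_distrib, ← prod_mul_distrib]
      refine prod_congr rfl fun j _ => ?_
      have e1 : q ^ (-(j : ℤ) - 1) = (q ^ (j + 1))⁻¹ := by
        rw [← zpow_natCast, ← zpow_neg]; congr 1; push_cast; ring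
      have hj := pow_ne_zero (j + 1) hq
      have e2 : 1 - b * (q ^ (j + 1))⁻¹ =
          -(1 - a⁻¹ * q * (a * b⁻¹) * q ^ j) * (b * (q ^ (j + 1))⁻¹) := by
        field_simp; ring
      have e3 : 1 - a * q / b * (q ^ (j + 1))⁻¹ = -(a * b⁻¹ - q ^ j) / q ^ j := by
        field_simp; ring
      rw [e1, e2, e3, pow_succ]
      generalize 1 - a⁻¹ * q * (a * b⁻¹) * q ^ j = D
      generalize a * b⁻¹ - q ^ j = A
      by_cases hD : D = 0
      · simp [hD]
      · field_simp

theorem wpAdmissible_inv {q a b : ℂ} (h₁ : qPochInf q (a * q / b) ≠ 0)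
    (h₂ : qPochInf q (q / b) ≠ 0) : WpAdmissible q a b⁻¹ := by
  rw [div_eq_mul_inv] at h₁ h₂
  exact ⟨one_sub_ne_zero_of_qPochInf_ne_zero h₁, one_sub_ne_zero_of_qPochInf_ne_zero h₂⟩

/-- Bailey's very-well-poised `₆ψ₆` summation formula: the bilateral series
(as a limit of symmetric partial sums) equals the stated quotient of infinite
`q`-shifted factorials. -/
theorem bailey_6psi6 (q a b c d e : ℂ) (hq0 : 0 < ‖q‖) (hq1 : ‖q‖ < 1)
    (ha : a ≠ 0) (hb : b ≠ 0) (hc : c ≠ 0) (hd : d ≠ 0) (he : e ≠ 0)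
    (harg : ‖a^2*q/(b*c*d*e)‖ < 1)
    (hgen : ∀ n : ℤ, qPoch q (a*q/b) n ≠ 0 ∧ qPoch q (a*q/c) n ≠ 0 ∧
      qPoch q (a*q/d) n ≠ 0 ∧ qPoch q (a*q/e) n ≠ 0)
    (h1 : 1 - a ≠ 0)
    (hd1 : qPochInf q (a*q/b) ≠ 0) (hd2 : qPochInf q (a*q/c) ≠ 0)
    (hd3 : qPochInf q (a*q/d) ≠ 0) (hd4 : qPochInf q (a*q/e) ≠ 0)
    (hd5 : qPochInf q (q/b) ≠ 0) (hd6 : qPochInf q (q/c) ≠ 0)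
    (hd7 : qPochInf q (q/d) ≠ 0) (hd8 : qPochInf q (q/e) ≠ 0)
    (hd9 : qPochInf q (a^2*q/(b*c*d*e)) ≠ 0) :
    Filter.Tendsto
      (fun N : ℕ => ∑ n ∈ Finset.Icc (-(N : ℤ)) (N : ℤ),
        (1 - a*q^(2*n)) / (1 - a) *
        ((qPoch q b n * qPoch q c n * qPoch q d n * qPoch q e n) /
         (qPoch q (a*q/b) n * qPoch q (a*q/c) n * qPoch q (a*q/d) n * qPoch q (a*q/e) n)) *
        (a^2*q/(b*c*d*e))^n) Filter.atTop
      (nhds ((qPochInf q q * qPochInf q (a*q) * qPochInf q (q/a) *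
          qPochInf q (a*q/(b*e)) * qPochInf q (a*q/(c*e)) * qPochInf q (a*q/(d*e)) *
          qPochInf q (a*q/(b*c)) * qPochInf q (a*q/(b*d)) * qPochInf q (a*q/(c*d))) /
        (qPochInf q (a*q/b) * qPochInf q (a*q/c) * qPochInf q (a*q/d) *
          qPochInf q (a*q/e) * qPochInf q (q/b) * qPochInf q (q/c) *
          qPochInf q (q/d) * qPochInf q (q/e) * qPochInf q (a^2*q/(b*c*d*e))))) := by
  have hq : q ≠ 0 := norm_pos_iff.1 hq0
  have A₁ := wpAdmissible_inv hd1 hd5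
  have A₂ := wpAdmissible_inv hd2 hd6
  have A₃ := wpAdmissible_inv hd3 hd7
  have A₄ := wpAdmissible_inv hd4 hd8
  have ez : a ^ 2 * q * (b⁻¹ * c⁻¹ * d⁻¹ * e⁻¹) = a ^ 2 * q / (b * c * d * e) := by field_simp
  have hz : ‖a ^ 2 * q * (b⁻¹ * c⁻¹ * d⁻¹ * e⁻¹)‖ < 1 := by rwa [ez]
  have key := tsum_vwpTerm_mul_eq hq hq1 ha (inv_ne_zero hb) (inv_ne_zero hc) (inv_ne_zero hd)
    (inv_ne_zero he) A₁ A₂ A₃ A₄ hz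
  have hs := ((summable_vwpTerm hq hq1 ha (inv_ne_zero hb) (inv_ne_zero hc) (inv_ne_zero hd)
    (inv_ne_zero he) A₁ A₂ A₃ A₄ hz).hasSum.mul_left (1 - a)⁻¹).comp (tendsto_Icc_neg (R := ℤ))
  rw [tsum_vwpTerm_zero hq hq1 ha, ez] at key
  have hm (u v : ℂ) : a * q * (u⁻¹ * v⁻¹) = a * q / (u * v) := by rw [← mul_inv, div_eq_mul_inv]
  simp only [hm] at key
  simp only [← div_eq_mul_inv] at key
  convert hs using 1
  · funext N
    refine sum_congr rfl fun n _ => ?_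
    have e₁ : (a ^ 2 * q / (b * c * d * e)) ^ n =
        (a ^ 2 * q) ^ n * (b⁻¹ ^ n * c⁻¹ ^ n * d⁻¹ ^ n * e⁻¹ ^ n) := by
      rw [← ez, mul_zpow _ (b⁻¹ * c⁻¹ * d⁻¹ * e⁻¹), mul_zpow _ e⁻¹, mul_zpow _ d⁻¹,
        mul_zpow b⁻¹]
    change _ = (1 - a)⁻¹ * vwpTerm q a b⁻¹ c⁻¹ d⁻¹ e⁻¹ n
    rw [vwpTerm, wpInt_inv hq ha hb, wpInt_inv hq ha hc, wpInt_inv hq ha hd, wpInt_inv hq ha he,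
      e₁, zpow_mul, zpow_ofNat]
    simp only [div_eq_mul_inv, mul_inv]
    ring
  · congr 1
    rw [div_eq_iff (by simp [*]), mul_assoc (1 - a)⁻¹, eq_inv_mul_iff_mul_eq₀ h1]
    linear_combination -key
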